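/- Let f : ℝ^{d×d}_sym → ℝ be a continuous symmetric-quasiconvex function. Then f is convex along symmetric rank-one directions: for all symmetric matrices A, B ∈ ℝ^{d×d}_sym with B − A = a⊙b for some vectors a, b ∈ ℝ^d, and all θ ∈ [0,1], f(θA + (1−θ)B) ≤ θ f(A) + (1−θ) f(B). -/

import Mathlib

open MeasureTheory

/-- The symmetrized gradient `𝓔ψ(x) = (Dψ(x) + Dψ(x)ᵀ)/2` (via `fderiv`; a.e. defined for
Lipschitz maps by Rademacher's theorem). -/
noncomputable def symGradE {d : ℕ} (u : EuclideanSpace ℝ (Fin d) → EuclideanSpace ℝ (Fin d))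
    (x : EuclideanSpace ℝ (Fin d)) : Matrix (Fin d) (Fin d) ℝ :=
  fun i j =>
    (fderiv ℝ u x (EuclideanSpace.single j 1) i + fderiv ℝ u x (EuclideanSpace.single i 1) j) / 2

/-- The symmetric tensor product `a ⊙ b := (a ⊗ b + b ⊗ a)/2`. -/
noncomputable def symTensor {d : ℕ} (a b : Fin d → ℝ) : Matrix (Fin d) (Fin d) ℝ :=
  fun i j => (a i * b j + b i * a j) / 2

open Filter Topology

/-- A continuous midpoint-convex function on the real line satisfies the chord inequality
on `[0, 1]`. -/
theorem le_chord_of_midpoint_convex {g : ℝ → ℝ} (hg : Continuous g)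
    (hmid : ∀ s t, 2 * g ((s + t) / 2) ≤ g s + g t) {t : ℝ} (ht : t ∈ Set.Icc (0 : ℝ) 1) :
    g t ≤ (1 - t) * g 0 + t * g 1 := by
  set φ : ℝ → ℝ := fun s => g s - ((1 - s) * g 0 + s * g 1) with hφ
  have hφc : Continuous φ := by fun_prop
  have hφm : ∀ s t, 2 * φ ((s + t) / 2) ≤ φ s + φ t := by
    intro s t
    have := hmid s t
    simp only [hφ]
    linarith
  have h0 : φ 0 = 0 := by simp [hφ]
  have h1 : φ 1 = 0 := by simp [hφ]
  obtain ⟨m, hm, hmax⟩ := isCompact_Icc.exists_isMaxOn ⟨t, ht⟩ hφc.continuousOn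
  have hmt : φ t ≤ φ m := hmax ht
  suffices φ m ≤ 0 by
    have := hmt.trans this
    simp only [hφ] at this
    linarith
  rcases le_total m (1 / 2) with h | h
  · have h2 : φ (2 * m) ≤ φ m := hmax ⟨by linarith [hm.1], by linarith⟩
    have h3 := hφm 0 (2 * m)
    rw [show (0 + 2 * m) / 2 = m by ring] at h3
    linarith
  · have h2 : φ (2 * m - 1) ≤ φ m := hmax ⟨by linarith, by linarith [hm.2]⟩
    have h3 := hφm 1 (2 * m - 1)
    rw [show (1 + (2 * m - 1)) / 2 = m by ring] at h3
    linarith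

/-- The distance to the lattice `pℤ` has slope `±1` away from multiples of `p / 2`. -/
theorem hasDerivAt_norm_addCircle_coe {p t : ℝ} (hp : 0 < p)
    (ht : ∀ m : ℤ, t ≠ m * (p / 2)) :
    HasDerivAt (fun s : ℝ => ‖(s : AddCircle p)‖) 1 t ∨
      HasDerivAt (fun s : ℝ => ‖(s : AddCircle p)‖) (-1) t := by
  set n : ℤ := round (t / p) with hn
  have hle : |t - n * p| ≤ p / 2 := by
    have h := abs_sub_round (t / p)
    have h' : t - n * p = p * (t / p - round (t / p)) := by
      rw [← hn]
      field_simp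
    rw [h', abs_mul, abs_of_pos hp]
    nlinarith
  have hlt : |t - n * p| < p / 2 := by
    refine lt_of_le_of_ne hle fun h => ?_
    rcases eq_or_eq_neg_of_abs_eq h with h | h
    · exact ht (2 * n + 1) (by push_cast; linarith)
    · exact ht (2 * n - 1) (by push_cast; linarith)
  have hne : t - n * p ≠ 0 := fun h => ht (2 * n) (by push_cast; linarith)
  have hev : (fun s : ℝ => ‖(s : AddCircle p)‖) =ᶠ[𝓝 t] fun s => |s - n * p| := by
    have hc : ContinuousAt (fun s : ℝ => |s - n * p|) t := by fun_prop
    filter_upwards [hc.eventually_lt continuousAt_const hlt] with s hs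
    have h1 : ((s - n * p : ℝ) : AddCircle p) = (s : AddCircle p) := by
      rw [AddCircle.coe_sub, sub_eq_self, AddCircle.coe_eq_zero_iff]
      exact ⟨n, by simp⟩
    rw [← h1, AddCircle.norm_coe_eq_abs_iff p hp.ne', abs_of_pos hp]
    exact hs.le
  have hid : HasDerivAt (fun s : ℝ => s - n * p) 1 t := (hasDerivAt_id t).sub_const _
  rcases lt_or_gt_of_ne hne with h | h
  · right
    have := (hasDerivAt_abs_neg h).comp t hid
    simpa using HasDerivAt.congr_of_eventuallyEq this hev
  · left
    have := (hasDerivAt_abs_pos h).comp t hid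
    simpa using HasDerivAt.congr_of_eventuallyEq this hev

/-- A nonzero linear functional avoids a countable set almost everywhere. -/
theorem ae_notMem_of_countable {E : Type*} [NormedAddCommGroup E] [NormedSpace ℝ E]
    [MeasurableSpace E] [BorelSpace E] [FiniteDimensional ℝ E] (μ : Measure E)
    [μ.IsAddHaarMeasure] {ℓ : E →L[ℝ] ℝ} (hℓ : ℓ ≠ 0) {S : Set ℝ} (hS : S.Countable) :
    ∀ᵐ x ∂μ, ℓ x ∉ S := by
  have hsurj : Function.Surjective (ℓ : E →ₗ[ℝ] ℝ) :=
    LinearMap.surjective fun h => hℓ (ContinuousLinearMap.coe_injective h)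
  exact (MeasureTheory.ae_comp_linearMap_mem_iff (ℓ : E →ₗ[ℝ] ℝ) μ volume hsurj
    hS.measurableSet.compl).2 (hS.ae_notMem volume)

theorem lipschitzWith_norm_addCircle_coe (p : ℝ) :
    LipschitzWith 1 fun s : ℝ => ‖(s : AddCircle p)‖ := by
  refine LipschitzWith.of_dist_le_mul fun s t => ?_
  rw [NNReal.coe_one, one_mul, Real.dist_eq, Real.dist_eq]
  calc |‖(s : AddCircle p)‖ - ‖(t : AddCircle p)‖|
      ≤ ‖(s : AddCircle p) - (t : AddCircle p)‖ := abs_norm_sub_norm_le _ _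
    _ = ‖((s - t : ℝ) : AddCircle p)‖ := by rw [AddCircle.coe_sub]
    _ ≤ |s - t| := QuotientAddGroup.norm_mk_le_norm

section OscillatingProfile

variable {E : Type*} [NormedAddCommGroup E] [NormedSpace ℝ E]

/-- A triangle wave of period `p` in the direction of the functional `ℓ`, cut off by the distance
to the complement of the unit ball. -/
noncomputable def cutoffWave (ℓ : E →L[ℝ] ℝ) (p : ℝ) (x : E) : ℝ :=
  min ‖((ℓ x : ℝ) : AddCircle p)‖ (max (1 - ‖x‖) 0)

theorem cutoffWave_eq_zero (ℓ : E →L[ℝ] ℝ) (p : ℝ) {x : E} (hx : 1 ≤ ‖x‖) :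
    cutoffWave ℓ p x = 0 := by
  simp [cutoffWave, max_eq_right (sub_nonpos.2 hx)]

theorem cutoffWave_neg (ℓ : E →L[ℝ] ℝ) (p : ℝ) (x : E) :
    cutoffWave ℓ p (-x) = cutoffWave ℓ p x := by
  simp [cutoffWave]

theorem lipschitzWith_cutoffWave (ℓ : E →L[ℝ] ℝ) (p : ℝ) :
    LipschitzWith (max ‖ℓ‖₊ 1) (cutoffWave ℓ p) := by
  have h1 : LipschitzWith ‖ℓ‖₊ fun x => ‖((ℓ x : ℝ) : AddCircle p)‖ := by
    have h := (lipschitzWith_norm_addCircle_coe p).comp ℓ.lipschitz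
    rwa [one_mul] at h
  have h2 : LipschitzWith 1 fun x : E => max (1 - ‖x‖) 0 := by
    refine LipschitzWith.max_const ?_ 0
    refine LipschitzWith.of_dist_le_mul fun x y => ?_
    rw [NNReal.coe_one, one_mul, Real.dist_eq, dist_eq_norm, sub_sub_sub_cancel_left, abs_sub_comm]
    exact abs_norm_sub_norm_le x y
  exact h1.min h2

/-- Where the cutoff is inactive, the profile has gradient `±ℓ` off a countable union of level
sets of `ℓ`. -/
theorem hasFDerivAt_cutoffWave {ℓ : E →L[ℝ] ℝ} {p : ℝ} (hp : 0 < p) {x : E}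
    (hx : p < 1 - ‖x‖) (hℓx : ∀ m : ℤ, ℓ x ≠ m * (p / 2)) :
    HasFDerivAt (cutoffWave ℓ p) ℓ x ∨ HasFDerivAt (cutoffWave ℓ p) (-ℓ) x := by
  have hev : cutoffWave ℓ p =ᶠ[𝓝 x] fun y => ‖((ℓ y : ℝ) : AddCircle p)‖ := by
    have hc : ContinuousAt (fun y : E => 1 - ‖y‖) x := by fun_prop
    filter_upwards [continuousAt_const.eventually_lt hc hx] with y hy
    have := AddCircle.norm_le_half_period p (x := ((ℓ y : ℝ) : AddCircle p)) hp.ne'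
    rw [abs_of_pos hp] at this
    exact min_eq_left (le_max_of_le_left (by linarith))
  rcases hasDerivAt_norm_addCircle_coe hp hℓx with h | h
  · left
    have := h.comp_hasFDerivAt x ℓ.hasFDerivAt
    rw [one_smul] at this
    exact HasFDerivAt.congr_of_eventuallyEq this hev
  · right
    have := h.comp_hasFDerivAt x ℓ.hasFDerivAt
    rw [neg_one_smul] at this
    exact HasFDerivAt.congr_of_eventuallyEq this hev

end OscillatingProfile

section SymGrad

variable {d : ℕ}

theorem symGradE_isSymm (u : EuclideanSpace ℝ (Fin d) → EuclideanSpace ℝ (Fin d))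
    (x : EuclideanSpace ℝ (Fin d)) : (symGradE u x).IsSymm := by
  ext i j
  simp [symGradE, add_comm]

theorem symTensor_isSymm (a b : Fin d → ℝ) : (symTensor a b).IsSymm := by
  ext i j
  simp only [Matrix.transpose_apply, symTensor]
  ring

theorem abs_symGradE_le {u : EuclideanSpace ℝ (Fin d) → EuclideanSpace ℝ (Fin d)} {K : NNReal}
    (hu : LipschitzWith K u) (x : EuclideanSpace ℝ (Fin d)) (i j : Fin d) :
    |symGradE u x i j| ≤ K := by
  have key : ∀ i j, |fderiv ℝ u x (EuclideanSpace.single j 1) i| ≤ K := by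
    intro i j
    calc |fderiv ℝ u x (EuclideanSpace.single j 1) i|
        ≤ ‖fderiv ℝ u x (EuclideanSpace.single j 1)‖ := PiLp.norm_apply_le (p := 2) (fderiv ℝ u x (EuclideanSpace.single j 1)) i
      _ ≤ ‖fderiv ℝ u x‖ * ‖EuclideanSpace.single j (1 : ℝ)‖ := ContinuousLinearMap.le_opNorm _ _
      _ ≤ K := by
        simpa using norm_fderiv_le_of_lipschitz ℝ (x₀ := x) hu
  have h1 := abs_le.1 (key i j)
  have h2 := abs_le.1 (key j i)
  rw [symGradE, abs_le]
  constructor <;> linarith [h1.1, h1.2, h2.1, h2.2]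

theorem symGradE_neg_of_even {u : EuclideanSpace ℝ (Fin d) → EuclideanSpace ℝ (Fin d)}
    (hu : ∀ x, u (-x) = u x) (x : EuclideanSpace ℝ (Fin d)) :
    symGradE u (-x) = -symGradE u x := by
  have h : fderiv ℝ u (-x) = -fderiv ℝ u x := by
    have h1 := (ContinuousLinearEquiv.neg ℝ (M := EuclideanSpace ℝ (Fin d))).comp_right_fderiv
      (f := u) (x := x)
    have h2 : u ∘ (ContinuousLinearEquiv.neg ℝ (M := EuclideanSpace ℝ (Fin d))) = u :=
      funext hu
    rw [h2] at h1
    ext v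
    simp [h1]
  ext i j
  simp only [symGradE, h, neg_apply, PiLp.neg_apply, Matrix.neg_apply]
  ring

theorem measurable_symGradE_apply (u : EuclideanSpace ℝ (Fin d) → EuclideanSpace ℝ (Fin d))
    (i j : Fin d) : Measurable fun x => symGradE u x i j := by
  have key : ∀ i j, Measurable fun x => fderiv ℝ u x (EuclideanSpace.single j 1) i := fun i j =>
    (EuclideanSpace.proj (𝕜 := ℝ) i).continuous.measurable.comp
      (measurable_fderiv_apply_const ℝ u _)
  exact ((key i j).add (key j i)).div_const 2

/-- The symmetrized gradient of a scalar profile times a fixed vector. -/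
theorem symGradE_smul_const {g : EuclideanSpace ℝ (Fin d) → ℝ} {b : Fin d → ℝ} {c : ℝ}
    {x : EuclideanSpace ℝ (Fin d)} (a : Fin d → ℝ)
    (hg : HasFDerivAt g (c • innerSL ℝ (WithLp.toLp 2 b)) x) :
    symGradE (fun y => g y • WithLp.toLp 2 a) x = c • symTensor a b := by
  ext i j
  rw [symGradE, (hg.smul_const (WithLp.toLp 2 a)).fderiv]
  simp [symTensor, EuclideanSpace.inner_single_right]
  ring

end SymGrad

section Midpoint

variable {d : ℕ}

/-- A function continuous on the symmetric matrices is bounded on bounded sets of them. -/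
theorem exists_abs_le_of_continuousOn_isSymm {f : Matrix (Fin d) (Fin d) ℝ → ℝ}
    (hfc : ContinuousOn f {M | M.IsSymm}) (C : Matrix (Fin d) (Fin d) ℝ) (hC : C.IsSymm) (R : ℝ) :
    ∃ M, ∀ G : Matrix (Fin d) (Fin d) ℝ, G.IsSymm → (∀ i j, |G i j| ≤ R) → |f (C + G)| ≤ M := by
  have hK : IsCompact (Set.univ.pi fun _ : Fin d => Set.univ.pi fun _ : Fin d => Set.Icc (-R) R) :=
    isCompact_univ_pi fun _ => isCompact_univ_pi fun _ => isCompact_Icc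
  have hS : IsClosed {M : Matrix (Fin d) (Fin d) ℝ | M.IsSymm} :=
    isClosed_eq (by fun_prop) continuous_id
  have hcont : ContinuousOn (fun G : Matrix (Fin d) (Fin d) ℝ => f (C + G)) {M | M.IsSymm} :=
    hfc.comp (by fun_prop) fun G hG => hC.add hG
  obtain ⟨M, hM⟩ := (IsCompact.inter_left (X := Matrix (Fin d) (Fin d) ℝ) hK
    hS).exists_bound_of_continuousOn (hcont.mono Set.inter_subset_left)
  exact ⟨M, fun G hG hR => hM G ⟨hG, fun i _ j _ => abs_le.1 (hR i j)⟩⟩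

theorem measurable_comp_symGradE {f : Matrix (Fin d) (Fin d) ℝ → ℝ}
    (hfc : ContinuousOn f {M | M.IsSymm}) {C : Matrix (Fin d) (Fin d) ℝ} (hC : C.IsSymm)
    (u : EuclideanSpace ℝ (Fin d) → EuclideanSpace ℝ (Fin d)) :
    Measurable fun x => f (C + symGradE u x) := by
  have hf : Continuous fun G : Fin d → Fin d → ℝ =>
      f (C + (1 / 2 : ℝ) • (Matrix.of G + (Matrix.of G).transpose)) := by
    refine hfc.comp_continuous ?_ fun G => ?_
    · have hof : Continuous fun G : Fin d → Fin d → ℝ => Matrix.of G := continuous_id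
      have hsum : Continuous fun G : Fin d → Fin d → ℝ =>
          Matrix.of G + (Matrix.of G).transpose := hof.add hof.matrix_transpose
      exact continuous_const.add (hsum.const_smul (1 / 2 : ℝ))
    · exact hC.add ((Matrix.isSymm_add_transpose_self _).smul _)
  have hm : Measurable fun x => (fun i j => symGradE u x i j : Fin d → Fin d → ℝ) :=
    measurable_pi_iff.2 fun i => measurable_pi_iff.2 fun j => measurable_symGradE_apply u i j
  convert hf.measurable.comp hm using 2 with x
  refine congrArg (fun G => f (C + G)) ?_
  ext i j
  have := (symGradE_isSymm u x).apply i j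
  simp [this]
  ring

/-- Symmetrizing the quasiconvexity inequality for even test fields. -/
theorem two_mul_volume_mul_le_integral {f : Matrix (Fin d) (Fin d) ℝ → ℝ}
    (hfc : ContinuousOn f {M | M.IsSymm})
    {C : Matrix (Fin d) (Fin d) ℝ} (hC : C.IsSymm)
    {ψ : EuclideanSpace ℝ (Fin d) → EuclideanSpace ℝ (Fin d)} {K : NNReal}
    (hψ : LipschitzWith K ψ) (heven : ∀ x, ψ (-x) = ψ x)
    (hle : f C ≤ ⨍ y in Metric.ball (0 : EuclideanSpace ℝ (Fin d)) 1, f (C + symGradE ψ y)) :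
    2 * (volume.real (Metric.ball (0 : EuclideanSpace ℝ (Fin d)) 1) * f C) ≤
      ∫ y in Metric.ball (0 : EuclideanSpace ℝ (Fin d)) 1,
        (f (C + symGradE ψ y) + f (C - symGradE ψ y)) := by
  set U := Metric.ball (0 : EuclideanSpace ℝ (Fin d)) 1 with hU
  obtain ⟨M, hM⟩ := exists_abs_le_of_continuousOn_isSymm hfc C hC K
  have hvol : 0 < volume.real U :=
    ENNReal.toReal_pos (Metric.measure_ball_pos volume _ one_pos).ne' measure_ball_lt_top.ne
  have hint : IntegrableOn (fun y => f (C + symGradE ψ y)) U := by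
    refine Measure.integrableOn_of_bounded (M := M) measure_ball_lt_top.ne
      (measurable_comp_symGradE hfc hC ψ).aestronglyMeasurable (ae_of_all _ fun x => ?_)
    exact hM _ (symGradE_isSymm ψ x) (abs_symGradE_le hψ x)
  have hmp := Measure.measurePreserving_neg (volume : Measure (EuclideanSpace ℝ (Fin d)))
  have hemb := (MeasurableEquiv.neg (EuclideanSpace ℝ (Fin d))).measurableEmbedding
  have hpre : (Neg.neg : EuclideanSpace ℝ (Fin d) → _) ⁻¹' U = U := by
    ext x
    simp [hU]
  have hneg : (fun y => f (C + symGradE ψ (-y))) = fun y => f (C - symGradE ψ y) := by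
    funext y
    rw [symGradE_neg_of_even heven, sub_eq_add_neg]
  have hint' : IntegrableOn (fun y => f (C - symGradE ψ y)) U := by
    have := (hmp.integrableOn_comp_preimage hemb).2 hint
    rw [hpre] at this
    rwa [← hneg]
  have heq : ∫ y in U, f (C - symGradE ψ y) = ∫ y in U, f (C + symGradE ψ y) := by
    rw [← hneg]
    have := hmp.setIntegral_preimage_emb hemb (fun y => f (C + symGradE ψ y)) U
    rwa [hpre] at this
  rw [integral_add hint hint', heq, ← two_mul]
  rw [setAverage_eq, smul_eq_mul, ← div_eq_inv_mul, le_div_iff₀ hvol] at hle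
  linarith

/-- Symmetric-quasiconvexity implies midpoint convexity along symmetric rank-one directions. -/
theorem two_mul_le_of_symQuasiconvex {f : Matrix (Fin d) (Fin d) ℝ → ℝ}
    (hfc : ContinuousOn f {M | M.IsSymm})
    {C : Matrix (Fin d) (Fin d) ℝ} (hC : C.IsSymm)
    (hqc : ∀ ψ : EuclideanSpace ℝ (Fin d) → EuclideanSpace ℝ (Fin d),
        (∃ K, LipschitzWith K ψ) → (∀ x, 1 ≤ ‖x‖ → ψ x = 0) →
        f C ≤ ⨍ y in Metric.ball (0 : EuclideanSpace ℝ (Fin d)) 1, f (C + symGradE ψ y))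
    (a b : Fin d → ℝ) :
    2 * f C ≤ f (C + symTensor a b) + f (C - symTensor a b) := by
  set ℓ : EuclideanSpace ℝ (Fin d) →L[ℝ] ℝ := innerSL ℝ (WithLp.toLp 2 b) with hℓ
  rcases eq_or_ne b 0 with rfl | hb
  · have : symTensor a (0 : Fin d → ℝ) = 0 := by
      ext i j
      simp [symTensor]
    rw [this, add_zero, sub_zero, two_mul]
  have hℓ0 : ℓ ≠ 0 := by
    intro h
    apply hb
    have := congrArg norm h
    rw [hℓ, innerSL_apply_norm, norm_zero, norm_eq_zero] at this
    simpa using this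
  set p : ℕ → ℝ := fun n => 1 / ((n : ℝ) + 1) with hp
  have hp0 : ∀ n, 0 < p n := fun n => Nat.one_div_pos_of_nat
  set ψ : ℕ → EuclideanSpace ℝ (Fin d) → EuclideanSpace ℝ (Fin d) :=
    fun n x => cutoffWave ℓ (p n) x • WithLp.toLp 2 a with hψ
  set K : NNReal := ‖ContinuousLinearMap.toSpanSingleton ℝ (WithLp.toLp 2 a)‖₊ * max ‖ℓ‖₊ 1
  have hlip : ∀ n, LipschitzWith K (ψ n) := fun n =>
    (ContinuousLinearMap.toSpanSingleton ℝ (WithLp.toLp 2 a)).lipschitz.comp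
      (lipschitzWith_cutoffWave ℓ (p n))
  have heven : ∀ n x, ψ n (-x) = ψ n x := fun n x => by simp only [hψ, cutoffWave_neg]
  set U := Metric.ball (0 : EuclideanSpace ℝ (Fin d)) 1 with hU
  have hvol : 0 < volume.real U :=
    ENNReal.toReal_pos (Metric.measure_ball_pos volume _ one_pos).ne' measure_ball_lt_top.ne
  set H : ℕ → EuclideanSpace ℝ (Fin d) → ℝ := fun n x =>
    f (C + symGradE (ψ n) x) + f (C - symGradE (ψ n) x) with hH
  have hlow : ∀ n, 2 * (volume.real U * f C) ≤ ∫ x in U, H n x := fun n =>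
    two_mul_volume_mul_le_integral hfc hC (hlip n) (heven n)
      (hqc (ψ n) ⟨K, hlip n⟩ fun x hx => by simp only [hψ, cutoffWave_eq_zero ℓ _ hx, zero_smul])
  obtain ⟨M, hM⟩ := exists_abs_le_of_continuousOn_isSymm hfc C hC K
  have hgood : ∀ᵐ x : EuclideanSpace ℝ (Fin d), ∀ n, ∀ m : ℤ, ℓ x ≠ m * (p n / 2) := by
    have hcount : (Set.range fun q : ℕ × ℤ => (q.2 : ℝ) * (p q.1 / 2)).Countable :=
      Set.countable_range _
    filter_upwards [ae_notMem_of_countable volume hℓ0 hcount] with x hx n m h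
    exact hx ⟨(n, m), h.symm⟩
  have hlim : Tendsto (fun n => ∫ x in U, H n x) atTop
      (𝓝 (∫ _ in U, (f (C + symTensor a b) + f (C - symTensor a b)))) := by
    refine tendsto_integral_of_dominated_convergence (fun _ => M + M) (fun n => ?_)
      (integrableOn_const measure_ball_lt_top.ne) (fun n => ae_of_all _ fun x => ?_) ?_
    · have h := measurable_comp_symGradE hfc hC (ψ n)
      have h' : (fun x => f (C - symGradE (ψ n) x)) = fun x => f (C + symGradE (ψ n) (-x)) := by
        funext x
        rw [symGradE_neg_of_even (heven n), sub_eq_add_neg]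
      refine (h.add ?_).aestronglyMeasurable
      rw [h']
      exact h.comp measurable_neg
    · refine (norm_add_le _ _).trans (add_le_add ?_ ?_)
      · exact hM _ (symGradE_isSymm _ x) (abs_symGradE_le (hlip n) x)
      · rw [sub_eq_add_neg]
        exact hM _ (symGradE_isSymm _ x).neg fun i j => by
          simpa using abs_symGradE_le (hlip n) x i j
    · filter_upwards [ae_restrict_mem measurableSet_ball, ae_restrict_of_ae hgood] with x hxU hx
      have hx1 : 0 < 1 - ‖x‖ := by simpa [hU] using hxU
      refine tendsto_const_nhds.congr' ?_
      filter_upwards [(tendsto_one_div_add_atTop_nhds_zero_nat (𝕜 := ℝ)).eventually_lt_const hx1]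
        with n hn
      rcases hasFDerivAt_cutoffWave (hp0 n) hn (hx n) with h | h
      · have := symGradE_smul_const (c := 1) (b := b) a (by rwa [one_smul])
        simp only [hH, hψ, this, one_smul]
      · have := symGradE_smul_const (c := -1) (b := b) a (by rwa [neg_one_smul])
        simp only [hH, hψ, this, neg_one_smul, sub_neg_eq_add, ← sub_eq_add_neg]
        exact add_comm _ _
  have hfin := ge_of_tendsto' hlim hlow
  rw [setIntegral_const, smul_eq_mul, mul_left_comm] at hfin
  exact le_of_mul_le_mul_left hfin hvol

end Midpoint

/-- A continuous symmetric-quasiconvex function `f` on the symmetric matrices is convex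
along symmetric rank-one directions: if `B − A = a ⊙ b` then
`f(θA + (1−θ)B) ≤ θ f(A) + (1−θ) f(B)` for all `θ ∈ [0,1]`. Symmetric-quasiconvexity is the
requirement `f(A) ≤ ⨍_{B₁} f(A + 𝓔ψ)` for all Lipschitz `ψ` vanishing outside `B₁`. -/
theorem symQuasiconvex_rankOne_convex {d : ℕ} (f : Matrix (Fin d) (Fin d) ℝ → ℝ)
    (hfc : ContinuousOn f {M | M.IsSymm})
    (hqc : ∀ A : Matrix (Fin d) (Fin d) ℝ, A.IsSymm →
      ∀ ψ : EuclideanSpace ℝ (Fin d) → EuclideanSpace ℝ (Fin d),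
        (∃ K, LipschitzWith K ψ) → (∀ x, 1 ≤ ‖x‖ → ψ x = 0) →
        f A ≤ ⨍ y in Metric.ball (0 : EuclideanSpace ℝ (Fin d)) 1, f (A + symGradE ψ y))
    (A B : Matrix (Fin d) (Fin d) ℝ) (hA : A.IsSymm) (hB : B.IsSymm)
    (hab : ∃ a b : Fin d → ℝ, B - A = symTensor a b)
    (θ : ℝ) (hθ0 : 0 ≤ θ) (hθ1 : θ ≤ 1) :
    f (θ • A + (1 - θ) • B) ≤ θ * f A + (1 - θ) * f B := by
  obtain ⟨a, b, hab⟩ := hab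
  have hT : (symTensor a b).IsSymm := symTensor_isSymm a b
  have hcont : Continuous fun t : ℝ => f (A + t • symTensor a b) :=
    hfc.comp_continuous (by fun_prop) fun t => hA.add (hT.smul t)
  have key := le_chord_of_midpoint_convex hcont (fun s t => ?_) (t := 1 - θ)
    ⟨by linarith, by linarith⟩
  · rw [zero_smul, one_smul, add_zero, ← hab, add_sub_cancel] at key
    have h : θ • A + (1 - θ) • B = A + (1 - θ) • (B - A) := by module
    rw [h]
    linarith
  · have hsm : symTensor (((s - t) / 2) • a) b = ((s - t) / 2) • symTensor a b := by
      ext i j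
      simp only [symTensor, Pi.smul_apply, Matrix.smul_apply, smul_eq_mul]
      ring
    have hC : (A + ((s + t) / 2) • symTensor a b).IsSymm := hA.add (hT.smul _)
    have h := two_mul_le_of_symQuasiconvex hfc hC (hqc _ hC) (((s - t) / 2) • a) b
    rw [hsm] at h
    convert h using 3
    · module
    · module
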